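/- arXiv:1907.10101 — 3 statements merged into one kernel-verified Lean document; each statement's English description precedes it below -/
import Mathlib

section
/- In any routing game in which every edge cost c_e is continuous and strictly increasing, the equilibrium edge loads are unique and continuous in the demand: for each μ > 0 any two Wardrop equilibria at demand μ induce the same edge loads x_e(μ), and for every edge e the function μ ↦ x_e(μ) is continuous on (0,∞). -/
open Finset Set

noncomputable section

variable {E P : Type*}

/-- The load induced on edge `e` by a path-flow `f`. -/
def edgeLoad [Fintype P] [DecidableEq E] (path : P → Finset E) (f : P → ℝ) (e : E) : ℝ :=
  ∑ p, if e ∈ path p then f p else 0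

/-- A flow is feasible for demand `μ` if it is nonnegative and routes total demand `μ`. -/
def Feasible [Fintype P] (f : P → ℝ) (μ : ℝ) : Prop :=
  (∀ p, 0 ≤ f p) ∧ ∑ p, f p = μ

/-- The cost of path `p` under flow `f`. -/
def pathCost [Fintype P] [DecidableEq E] (path : P → Finset E) (c : E → ℝ → ℝ)
    (f : P → ℝ) (p : P) : ℝ :=
  ∑ e ∈ path p, c e (edgeLoad path f e)

/-- Wardrop equilibrium with equilibrium cost `lam` at demand `μ`. -/
def IsWardrop [Fintype P] [DecidableEq E] (path : P → Finset E) (c : E → ℝ → ℝ)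
    (μ : ℝ) (f : P → ℝ) (lam : ℝ) : Prop :=
  Feasible f μ ∧ (∀ p, 0 < f p → pathCost path c f p = lam) ∧
    ∀ p, lam ≤ pathCost path c f p

/-- Social cost of a flow. -/
def socialCost [Fintype E] [Fintype P] [DecidableEq E] (path : P → Finset E)
    (c : E → ℝ → ℝ) (f : P → ℝ) : ℝ :=
  ∑ e, edgeLoad path f e * c e (edgeLoad path f e)

/-- The active network: edges lying on some path of cost `lam` (the minimal cost). -/
def activeNet [Fintype P] [DecidableEq E] (path : P → Finset E) (c : E → ℝ → ℝ)
    (f : P → ℝ) (lam : ℝ) : Set E :=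
  {e | ∃ p, pathCost path c f p = lam ∧ e ∈ path p}

/-- `μ₀` is a breakpoint of the active-network map `Act`. -/
def IsBreakpoint (Act : ℝ → Set E) (μ₀ : ℝ) : Prop :=
  0 < μ₀ ∧ ∃ ε > 0,
    (∀ μ ∈ Set.Ico (μ₀ - ε) μ₀, Act μ = Act (μ₀ - ε)) ∧
    (∀ μ ∈ Set.Ioc μ₀ (μ₀ + ε), Act μ = Act (μ₀ + ε)) ∧
    Act (μ₀ - ε) ≠ Act (μ₀ + ε)

theorem sum_edgeLoad_mul [Fintype E] [DecidableEq E] [Fintype P] (path : P → Finset E)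
    (f : P → ℝ) (w : E → ℝ) :
    ∑ e, w e * edgeLoad path f e = ∑ p, (∑ e ∈ path p, w e) * f p := by
  simp only [edgeLoad, Finset.mul_sum, Finset.sum_mul]
  rw [Finset.sum_comm]
  refine Finset.sum_congr rfl fun p _ => ?_
  simp [mul_ite, Finset.sum_ite_mem]

theorem edgeLoad_le_demand [DecidableEq E] [Fintype P] (path : P → Finset E) {f : P → ℝ} {μ : ℝ}
    (hf : Feasible f μ) (e : E) : edgeLoad path f e ≤ μ := by
  rw [← hf.2]
  refine Finset.sum_le_sum fun p _ => ?_
  split_ifs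
  exacts [le_rfl, hf.1 p]

namespace IsWardrop

variable [DecidableEq E] [Fintype P] {path : P → Finset E} {c : E → ℝ → ℝ} {μ ν lam lam' : ℝ}
  {f g : P → ℝ}

theorem sum_pathCost_mul_self (hf : IsWardrop path c μ f lam) :
    ∑ p, pathCost path c f p * f p = lam * μ := by
  rw [← hf.1.2, Finset.mul_sum]
  refine Finset.sum_congr rfl fun p _ => ?_
  rcases (hf.1.1 p).eq_or_lt with h | h
  · simp [← h]
  · rw [hf.2.1 p h]

theorem mul_demand_le_sum_pathCost (hf : IsWardrop path c μ f lam) (hg : Feasible g ν) :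
    lam * ν ≤ ∑ p, pathCost path c f p * g p := by
  rw [← hg.2, Finset.mul_sum]
  exact Finset.sum_le_sum fun p _ => mul_le_mul_of_nonneg_right (hf.2.2 p) (hg.1 p)

/-- Monotonicity estimate comparing equilibria at two demands. -/
theorem sum_cost_sub_mul_load_sub_le [Fintype E] (hf : IsWardrop path c μ f lam)
    (hg : IsWardrop path c ν g lam') :
    ∑ e, (c e (edgeLoad path f e) - c e (edgeLoad path g e)) *
      (edgeLoad path f e - edgeLoad path g e) ≤ (lam - lam') * (μ - ν) := by
  have hff := hf.sum_pathCost_mul_self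
  have hgg := hg.sum_pathCost_mul_self
  have hfg := hf.mul_demand_le_sum_pathCost hg.1
  have hgf := hg.mul_demand_le_sum_pathCost hf.1
  simp only [pathCost, ← sum_edgeLoad_mul] at hff hgg hfg hgf
  simp only [sub_mul, mul_sub, Finset.sum_sub_distrib]
  linarith

theorem equilibriumCost_nonneg (hc : ∀ e x, 0 ≤ c e x) (hμ : 0 < μ)
    (hf : IsWardrop path c μ f lam) : 0 ≤ lam := by
  have hsum : ∑ _p : P, (0 : ℝ) < ∑ p, f p := by rwa [Finset.sum_const_zero, hf.1.2]
  obtain ⟨p, -, hp⟩ := Finset.exists_lt_of_sum_lt hsum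
  rw [← hf.2.1 p hp]
  exact Finset.sum_nonneg fun e _ => hc e _

theorem equilibriumCost_le [Fintype E] [Nonempty P] (hc : ∀ e x, 0 ≤ c e x)
    (hmono : ∀ e, Monotone (c e)) (hf : IsWardrop path c μ f lam) (hμν : μ ≤ ν) :
    lam ≤ ∑ e, c e ν := by
  obtain ⟨p⟩ := ‹Nonempty P›
  calc lam ≤ ∑ e ∈ path p, c e (edgeLoad path f e) := hf.2.2 p
    _ ≤ ∑ e ∈ path p, c e ν :=
        Finset.sum_le_sum fun e _ => hmono e ((edgeLoad_le_demand path hf.1 e).trans hμν)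
    _ ≤ ∑ e, c e ν :=
        Finset.sum_le_sum_of_subset_of_nonneg (Finset.subset_univ _) fun e _ _ => hc e ν

theorem cost_sub_mul_load_sub_le [Fintype E] (hmono : ∀ e, Monotone (c e))
    (hf : IsWardrop path c μ f lam) (hg : IsWardrop path c ν g lam') (e : E) :
    (c e (edgeLoad path f e) - c e (edgeLoad path g e)) *
      (edgeLoad path f e - edgeLoad path g e) ≤ (lam - lam') * (μ - ν) := by
  refine le_trans ?_ (hf.sum_cost_sub_mul_load_sub_le hg)
  refine Finset.single_le_sum (f := fun e => (c e (edgeLoad path f e) - c e (edgeLoad path g e)) *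
      (edgeLoad path f e - edgeLoad path g e)) (fun e' _ => ?_) (Finset.mem_univ e)
  rcases le_total (edgeLoad path f e') (edgeLoad path g e') with h | h
  · exact mul_nonneg_of_nonpos_of_nonpos (sub_nonpos.2 (hmono e' h)) (sub_nonpos.2 h)
  · exact mul_nonneg (sub_nonneg.2 (hmono e' h)) (sub_nonneg.2 h)

end IsWardrop

theorem StrictMono.exists_pos_abs_sub_lt {h : ℝ → ℝ} (hh : StrictMono h) (y : ℝ) {ε : ℝ}
    (hε : 0 < ε) : ∃ δ > 0, ∀ x, (h x - h y) * (x - y) < δ → |x - y| < ε := by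
  have hr : 0 < h (y + ε) - h y := sub_pos.2 (hh (by linarith))
  have hl : 0 < h y - h (y - ε) := sub_pos.2 (hh (by linarith))
  refine ⟨min (h (y + ε) - h y) (h y - h (y - ε)) * ε, mul_pos (lt_min hr hl) hε, fun x hx => ?_⟩
  by_contra! hxy
  refine hx.not_ge ?_
  rcases le_abs.1 hxy with hxy | hxy
  · have hx' : h (y + ε) ≤ h x := hh.monotone (by linarith)
    exact mul_le_mul ((min_le_left _ _).trans (by linarith)) hxy hε.le (by linarith)
  · have hx' : h x ≤ h (y - ε) := hh.monotone (by linarith)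
    rw [← neg_mul_neg (h x - h y)]
    exact mul_le_mul ((min_le_right _ _).trans (by linarith)) hxy hε.le (by linarith)

/-- for strictly increasing continuous edge costs, equilibrium edge loads are
unique at each demand and depend continuously on the demand. -/
theorem equilibrium_loads_unique_continuous
    [Fintype E] [DecidableEq E] [Nonempty E] [Fintype P] [Nonempty P]
    (path : P → Finset E) (hpath : ∀ p, (path p).Nonempty)
    (c : E → ℝ → ℝ)
    (hc_cont : ∀ e, Continuous (c e))
    (hc_nonneg : ∀ e x, 0 ≤ c e x)
    (hc_strict : ∀ e, StrictMono (c e)) :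
    (∀ μ : ℝ, 0 < μ → ∀ f g lamf lamg,
      IsWardrop path c μ f lamf → IsWardrop path c μ g lamg →
      ∀ e, edgeLoad path f e = edgeLoad path g e) ∧
    (∀ (feq : ℝ → P → ℝ) (lamf : ℝ → ℝ),
      (∀ μ : ℝ, 0 < μ → IsWardrop path c μ (feq μ) (lamf μ)) →
      ∀ e, ContinuousOn (fun μ => edgeLoad path (feq μ) e) (Set.Ioi 0)) := by
  have hmono : ∀ e, Monotone (c e) := fun e => (hc_strict e).monotone
  constructor
  · intro μ _ f g lamf lamg hf hg e
    have hle := hf.cost_sub_mul_load_sub_le hmono hg e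
    rw [sub_self, mul_zero] at hle
    refine eq_of_abs_sub_nonpos (le_of_forall_pos_lt_add fun ε hε => ?_)
    obtain ⟨δ, hδ, hlt⟩ := (hc_strict e).exists_pos_abs_sub_lt (edgeLoad path g e) hε
    simpa using hlt _ (hle.trans_lt hδ)
  · intro feq lamf hW e
    rw [Metric.continuousOn_iff]
    intro μ hμ ε hε
    obtain ⟨δ, hδ, hlt⟩ := (hc_strict e).exists_pos_abs_sub_lt (edgeLoad path (feq μ) e) hε
    set M : ℝ := ∑ e, c e (μ + 1)
    have hM : 0 ≤ M := Finset.sum_nonneg fun e _ => hc_nonneg e _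
    refine ⟨min 1 (δ / (M + 1)), lt_min one_pos (by positivity), fun ν hν hdist => hlt _ ?_⟩
    rw [Real.dist_eq] at hdist
    have hclose : |ν - μ| < 1 := hdist.trans_le (min_le_left _ _)
    have hsmall : |ν - μ| * (M + 1) < δ :=
      (lt_div_iff₀ (by positivity)).1 (hdist.trans_le (min_le_right _ _))
    have hν_le : lamf ν ≤ M :=
      (hW ν hν).equilibriumCost_le hc_nonneg hmono (by linarith [le_abs_self (ν - μ)])
    have hμ_le : lamf μ ≤ M := (hW μ hμ).equilibriumCost_le hc_nonneg hmono (by linarith)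
    have hν_nonneg := (hW ν hν).equilibriumCost_nonneg hc_nonneg hν
    have hμ_nonneg := (hW μ hμ).equilibriumCost_nonneg hc_nonneg hμ
    have habs : |lamf ν - lamf μ| ≤ M + 1 := abs_le.2 ⟨by linarith, by linarith⟩
    calc _ ≤ (lamf ν - lamf μ) * (ν - μ) := (hW ν hν).cost_sub_mul_load_sub_le hmono (hW μ hμ) e
      _ ≤ |lamf ν - lamf μ| * |ν - μ| := (le_abs_self _).trans_eq (abs_mul _ _)
      _ ≤ (M + 1) * |ν - μ| := mul_le_mul_of_nonneg_right habs (abs_nonneg _)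
      _ < δ := by rwa [mul_comm]
end
end

section
/- In any routing game in which every edge cost c_e is C¹, nonnegative, nondecreasing, and such that t ↦ t·c_e(t) is convex on [0,∞), the optimal social cost function V* is convex on (0,∞) and continuously differentiable on (0,∞). -/
open Finset Set

noncomputable section

variable {E P : Type*}

/-- A convex function has an affine minorant touching it at any interior point. -/
theorem ConvexOn.exists_affine_le {S : Set ℝ} {V : ℝ → ℝ} {x : ℝ} (hV : ConvexOn ℝ S V)
    (hx : x ∈ interior S) : ∃ s, ∀ y ∈ S, V x + s * (y - x) ≤ V y := by
  refine ⟨derivWithin V (Set.Ioi x) x, fun y hy => ?_⟩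
  rcases lt_trichotomy y x with h | rfl | h
  · have h₁ := (hV.slope_le_leftDeriv_of_mem_interior hy hx h).trans
      (hV.leftDeriv_le_rightDeriv_of_mem_interior hx)
    rw [slope_def_field, div_le_iff₀ (sub_pos.2 h)] at h₁
    linarith
  · simp
  · have h₁ := hV.rightDeriv_le_slope_of_mem_interior hx hy h
    rw [slope_def_field, le_div_iff₀ (sub_pos.2 h)] at h₁
    linarith

/-- A convex function touched from above at an interior point by a differentiable function is
differentiable at that point. -/
theorem ConvexOn.differentiableAt_of_eventually_le {S : Set ℝ} {V g : ℝ → ℝ} {x : ℝ}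
    (hV : ConvexOn ℝ S V) (hx : x ∈ interior S) (hg : DifferentiableAt ℝ g x)
    (hle : ∀ᶠ y in nhds x, V y ≤ g y) (heq : g x = V x) : DifferentiableAt ℝ V x := by
  obtain ⟨s, hs⟩ := hV.exists_affine_le hx
  have hS : ∀ᶠ y in nhds x, y ∈ S := mem_interior_iff_mem_nhds.1 hx
  have hmin : IsLocalMin (fun y => g y - s * (y - x)) x := by
    filter_upwards [hle, hS] with y hy hyS
    have := hs y hyS
    simp only [sub_self, mul_zero, sub_zero]
    linarith
  have hderiv : HasDerivAt g s x := by
    have h₁ : HasDerivAt (fun y => g y - s * (y - x)) (deriv g x - s * 1) x :=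
      hg.hasDerivAt.sub (((hasDerivAt_id x).sub_const x).const_mul s)
    have h₂ := hmin.hasDerivAt_eq_zero h₁
    have h₃ : deriv g x = s := by linarith
    exact h₃ ▸ hg.hasDerivAt
  refine HasDerivAt.differentiableAt (f' := s) ?_
  rw [hasDerivAt_iff_isLittleO] at hderiv ⊢
  refine (Asymptotics.IsBigO.of_bound 1 ?_).trans_isLittleO hderiv
  filter_upwards [hle, hS] with y hy hyS
  have := hs y hyS
  simp only [smul_eq_mul, Real.norm_eq_abs, one_mul]
  rw [abs_of_nonneg (by linarith)]
  exact le_trans (by linarith) (le_abs_self _)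

/-- A convex function which is differentiable on an open set is continuously differentiable. -/
theorem ConvexOn.contDiffOn_one {S : Set ℝ} {V : ℝ → ℝ} (hV : ConvexOn ℝ S V) (hS : IsOpen S)
    (hd : ∀ x ∈ S, DifferentiableAt ℝ V x) : ContDiffOn ℝ 1 V S := by
  have hmono : MonotoneOn (deriv V) S := hV.monotoneOn_deriv hd
  have hdarboux : ∀ y ∈ S, ∀ z ∈ S, ∀ b, deriv V y ≤ b → b ≤ deriv V z →
      ∃ w ∈ S, deriv V w = b := fun y hy z hz b hyb hbz =>
    (hV.1.ordConnected.image_deriv hd).out (Set.mem_image_of_mem _ hy)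
      (Set.mem_image_of_mem _ hz) ⟨hyb, hbz⟩
  rw [contDiffOn_one_iff_derivWithin hS.uniqueDiffOn]
  refine ⟨fun x hx => (hd x hx).differentiableWithinAt, ?_⟩
  refine ContinuousOn.congr (f := deriv V) (fun a ha => ContinuousAt.continuousWithinAt ?_)
    fun x hx => derivWithin_of_isOpen hS hx
  obtain ⟨l, u, hau, hlu⟩ := mem_nhds_iff_exists_Ioo_subset.1 (hS.mem_nhds ha)
  refine tendsto_order.2 ⟨fun b hb => ?_, fun b hb => ?_⟩
  · obtain ⟨y, hly, hya⟩ := exists_between hau.1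
    have hy : y ∈ S := hlu ⟨hly, hya.trans hau.2⟩
    suffices ∃ z ∈ S, z < a ∧ b < deriv V z by
      obtain ⟨z, hz, hza, hbz⟩ := this
      filter_upwards [hS.mem_nhds ha, lt_mem_nhds hza] with x hx hzx
      exact hbz.trans_le (hmono hz hx hzx.le)
    obtain hby | hby := lt_or_ge b (deriv V y)
    · exact ⟨y, hy, hya, hby⟩
    · obtain ⟨b', hbb', hb'a⟩ := exists_between hb
      obtain ⟨w, hw, rfl⟩ := hdarboux y hy a ha b' (hby.trans hbb'.le) hb'a.le
      exact ⟨w, hw, lt_of_not_ge fun h => hb'a.not_ge (hmono ha hw h), hbb'⟩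
  · obtain ⟨y, hay, hyu⟩ := exists_between hau.2
    have hy : y ∈ S := hlu ⟨hau.1.trans hay, hyu⟩
    suffices ∃ z ∈ S, a < z ∧ deriv V z < b by
      obtain ⟨z, hz, hza, hbz⟩ := this
      filter_upwards [hS.mem_nhds ha, gt_mem_nhds hza] with x hx hzx
      exact (hmono hx hz hzx.le).trans_lt hbz
    obtain hby | hby := lt_or_ge (deriv V y) b
    · exact ⟨y, hy, hay, hby⟩
    · obtain ⟨b', hab', hb'b⟩ := exists_between hb
      obtain ⟨w, hw, rfl⟩ := hdarboux a ha y hy b' hab'.le (hb'b.le.trans hby)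
      exact ⟨w, hw, lt_of_not_ge fun h => hab'.not_ge (hmono hw ha h), hb'b⟩

section RoutingGame

variable [Fintype P] [DecidableEq E]

theorem edgeLoad_nonneg (path : P → Finset E) {f : P → ℝ} (hf : ∀ p, 0 ≤ f p) (e : E) :
    0 ≤ edgeLoad path f e := by
  refine Finset.sum_nonneg fun p _ => ?_
  split_ifs
  exacts [hf p, le_rfl]

theorem edgeLoad_add (path : P → Finset E) (f g : P → ℝ) (e : E) :
    edgeLoad path (f + g) e = edgeLoad path f e + edgeLoad path g e := by
  simp only [edgeLoad, ← Finset.sum_add_distrib]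
  refine Finset.sum_congr rfl fun p _ => ?_
  split_ifs <;> simp

theorem edgeLoad_smul (path : P → Finset E) (a : ℝ) (f : P → ℝ) (e : E) :
    edgeLoad path (a • f) e = a * edgeLoad path f e := by
  simp only [edgeLoad, Finset.mul_sum]
  refine Finset.sum_congr rfl fun p _ => ?_
  split_ifs <;> simp

theorem Feasible.add {f g : P → ℝ} {μ ν : ℝ} (hf : Feasible f μ) (hg : Feasible g ν) :
    Feasible (f + g) (μ + ν) :=
  ⟨fun p => add_nonneg (hf.1 p) (hg.1 p), by
    simp only [Pi.add_apply, Finset.sum_add_distrib, hf.2, hg.2]⟩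

theorem Feasible.smul {f : P → ℝ} {μ a : ℝ} (ha : 0 ≤ a) (hf : Feasible f μ) :
    Feasible (a • f) (a * μ) :=
  ⟨fun p => mul_nonneg ha (hf.1 p), by
    simp only [Pi.smul_apply, smul_eq_mul, ← Finset.mul_sum, hf.2]⟩

/-- Some path carries positive flow when the demand is positive. -/
theorem Feasible.exists_pos {f : P → ℝ} {μ : ℝ} (hf : Feasible f μ) (hμ : 0 < μ) :
    ∃ p, 0 < f p := by
  by_contra! h
  exact hμ.not_ge (hf.2 ▸ Finset.sum_nonpos fun p _ => h p)

/-- Changing the flow on a single path, as long as it stays nonnegative, gives a feasible flow. -/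
theorem Feasible.add_smul_single [DecidableEq P] {f : P → ℝ} {μ t : ℝ} {p : P}
    (hf : Feasible f μ) (ht : 0 ≤ f p + t) :
    Feasible (f + t • Pi.single p 1) (μ + t) := by
  refine ⟨fun q => ?_, ?_⟩
  · by_cases h : q = p
    · subst h
      simpa using ht
    · simpa [h] using hf.1 q
  · simp [Finset.sum_add_distrib, hf.2, ← Finset.mul_sum]

variable [Fintype E]

/-- The social cost is convex on nonnegative flows. -/
theorem convexOn_socialCost (path : P → Finset E) (c : E → ℝ → ℝ)
    (hc_conv : ∀ e, ConvexOn ℝ (Set.Ici 0) (fun t => t * c e t)) :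
    ConvexOn ℝ {f : P → ℝ | ∀ p, 0 ≤ f p} (socialCost path c) := by
  refine ⟨fun f hf g hg a b ha hb _ p =>
    add_nonneg (mul_nonneg ha (hf p)) (mul_nonneg hb (hg p)), fun f hf g hg a b ha hb hab => ?_⟩
  simp only [socialCost, smul_eq_mul, Finset.mul_sum, ← Finset.sum_add_distrib, edgeLoad_add,
    edgeLoad_smul]
  refine Finset.sum_le_sum fun e _ => ?_
  have h := (hc_conv e).2 (Set.mem_Ici.2 (edgeLoad_nonneg path hf e))
    (Set.mem_Ici.2 (edgeLoad_nonneg path hg e)) ha hb hab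
  simpa only [smul_eq_mul] using h

theorem differentiable_socialCost_line (path : P → Finset E) (c : E → ℝ → ℝ)
    (hc : ∀ e, Differentiable ℝ (c e)) (f g : P → ℝ) (μ : ℝ) :
    Differentiable ℝ fun ν => socialCost path c (f + (ν - μ) • g) := by
  simp only [socialCost, edgeLoad_add, edgeLoad_smul]
  refine Differentiable.fun_sum fun e _ => ?_
  have hload : Differentiable ℝ fun ν => edgeLoad path f e + (ν - μ) * edgeLoad path g e := by
    fun_prop
  exact hload.mul ((hc e).comp hload)

end RoutingGame

/-- for C¹, nonnegative, nondecreasing edge costs with `t ↦ t·c_e(t)` convex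
on `[0,∞)`, the optimal social cost `V*` is convex on `(0,∞)` and continuously
differentiable on `(0,∞)`. -/
theorem optimal_social_cost_C1
    [Fintype E] [DecidableEq E] [Nonempty E] [Fintype P] [Nonempty P]
    (path : P → Finset E) (hpath : ∀ p, (path p).Nonempty)
    (c : E → ℝ → ℝ)
    (hc_C1 : ∀ e, ContDiff ℝ 1 (c e))
    (hc_nonneg : ∀ e x, 0 ≤ c e x)
    (hc_mono : ∀ e, Monotone (c e))
    (hc_conv : ∀ e, ConvexOn ℝ (Set.Ici 0) (fun t => t * c e t))
    (Vstar : ℝ → ℝ)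
    (hVstar : ∀ μ : ℝ, 0 ≤ μ →
      IsLeast {y | ∃ f, Feasible f μ ∧ y = socialCost path c f} (Vstar μ)) :
    ConvexOn ℝ (Set.Ioi 0) Vstar ∧ ContDiffOn ℝ 1 Vstar (Set.Ioi 0) := by
  have hle : ∀ μ f, 0 ≤ μ → Feasible f μ → Vstar μ ≤ socialCost path c f :=
    fun μ f hμ hf => (hVstar μ hμ).2 ⟨f, hf, rfl⟩
  have hconv : ConvexOn ℝ (Set.Ioi 0) Vstar := by
    refine ⟨convex_Ioi 0, fun x hx y hy a b ha hb hab => ?_⟩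
    obtain ⟨f, hf, hfx⟩ := (hVstar x (le_of_lt hx)).1
    obtain ⟨g, hg, hgy⟩ := (hVstar y (le_of_lt hy)).1
    rw [hfx, hgy]
    have hpos : 0 < a • x + b • y := convex_Ioi (0 : ℝ) hx hy ha hb hab
    exact (hle _ (a • f + b • g) hpos.le ((hf.smul ha).add (hg.smul hb))).trans
      ((convexOn_socialCost path c hc_conv).2 hf.1 hg.1 ha hb hab)
  refine ⟨hconv, hconv.contDiffOn_one isOpen_Ioi fun μ hμ => ?_⟩
  rw [Set.mem_Ioi] at hμ
  classical
  obtain ⟨f, hf, hfμ⟩ := (hVstar μ (le_of_lt hμ)).1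
  obtain ⟨p, hp⟩ := hf.exists_pos hμ
  have hdiff := differentiable_socialCost_line path c
    (fun e => (hc_C1 e).differentiable one_ne_zero) f (Pi.single p 1) μ
  refine hconv.differentiableAt_of_eventually_le
    (by rwa [interior_Ioi, Set.mem_Ioi]) (hdiff μ) ?_ (by simp [hfμ])
  filter_upwards [lt_mem_nhds hμ, lt_mem_nhds (sub_lt_self μ hp)] with ν hν hν'
  have hfeas := hf.add_smul_single (p := p) (t := ν - μ) (by linarith)
  rw [add_sub_cancel] at hfeas
  exact hle ν _ hν.le hfeas
end
end

section
/- In any routing game with affine costs, the socially optimal flow at demand μ is half of the equilibrium flow at demand 2μ: if f is a Wardrop equilibrium at demand 2μ (μ ≥ 0), then the flow (1/2)·f is feasible at demand μ and minimizes the social cost SC over all feasible flows at demand μ. -/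
open Finset Set

noncomputable section

variable {E P : Type*}

/-- The total cost of a flow `g` under the edge costs induced by `f` can be summed over edges
or over paths. -/
theorem sum_edgeLoad_mul_eq_sum_mul_pathCost [Fintype E] [Fintype P] [DecidableEq E]
    (path : P → Finset E) (c : E → ℝ → ℝ) (f g : P → ℝ) :
    ∑ e, edgeLoad path g e * c e (edgeLoad path f e) = ∑ p, g p * pathCost path c f p := by
  simp only [pathCost, edgeLoad.eq_1 path g, Finset.sum_mul, Finset.mul_sum]
  rw [Finset.sum_comm]
  refine Finset.sum_congr rfl fun p _ => ?_
  simp [ite_mul]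

theorem edgeLoad_div [Fintype P] [DecidableEq E] (path : P → Finset E) (f : P → ℝ) (r : ℝ)
    (e : E) : edgeLoad path (fun p => f p / r) e = edgeLoad path f e / r := by
  simp [edgeLoad, Finset.sum_div, ite_div]

/-- The path costs of a Wardrop equilibrium weighted by its flow sum to demand times cost. -/
theorem IsWardrop.sum_mul_pathCost [Fintype P] [DecidableEq E] {path : P → Finset E}
    {c : E → ℝ → ℝ} {μ lam : ℝ} {f : P → ℝ} (hf : IsWardrop path c μ f lam) :
    ∑ p, f p * pathCost path c f p = μ * lam := by
  obtain ⟨⟨hnonneg, hsum⟩, hused, -⟩ := hf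
  rw [← hsum, Finset.sum_mul]
  refine Finset.sum_congr rfl fun p _ => ?_
  rcases (hnonneg p).eq_or_lt with h | h
  · simp [← h]
  · rw [hused p h]

/-- Under the path costs of a Wardrop equilibrium, any flow of demand `ν` costs at least
`ν * lam`. -/
theorem IsWardrop.mul_le_sum_mul_pathCost [Fintype P] [DecidableEq E] {path : P → Finset E}
    {c : E → ℝ → ℝ} {μ ν lam : ℝ} {f g : P → ℝ} (hf : IsWardrop path c μ f lam)
    (hg : Feasible g ν) : ν * lam ≤ ∑ p, g p * pathCost path c f p := by
  rw [← hg.2, Finset.sum_mul]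
  exact Finset.sum_le_sum fun p _ => mul_le_mul_of_nonneg_left (hf.2.2 p) (hg.1 p)

/-- with affine costs `c_e(x) = a_e·x + b_e` (`a_e, b_e ≥ 0`), if `f` is a
Wardrop equilibrium at demand `2μ` then `f/2` is feasible at demand `μ` and minimizes the
social cost among feasible flows at demand `μ`. -/
theorem half_equilibrium_is_social_optimum
    [Fintype E] [DecidableEq E] [Nonempty E] [Fintype P] [Nonempty P]
    (path : P → Finset E) (hpath : ∀ p, (path p).Nonempty)
    (a b : E → ℝ) (ha : ∀ e, 0 ≤ a e) (hb : ∀ e, 0 ≤ b e)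
    (c : E → ℝ → ℝ) (hc : ∀ e x, c e x = a e * x + b e)
    (μ : ℝ) (hμ : 0 ≤ μ)
    (f : P → ℝ) (lam : ℝ) (hf : IsWardrop path c (2 * μ) f lam) :
    Feasible (fun p => f p / 2) μ ∧
      ∀ g, Feasible g μ →
        socialCost path c (fun p => f p / 2) ≤ socialCost path c g := by
  refine ⟨⟨fun p => div_nonneg (hf.1.1 p) zero_le_two, ?_⟩, fun g hg => ?_⟩
  · rw [← Finset.sum_div, hf.1.2]
    ring
  have hedge : ∀ e, edgeLoad path f e / 2 * c e (edgeLoad path f e / 2) +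
      (edgeLoad path g e * c e (edgeLoad path f e) -
        edgeLoad path f e * c e (edgeLoad path f e) / 2) ≤
      edgeLoad path g e * c e (edgeLoad path g e) := fun e => by
    simp only [hc]
    nlinarith [mul_nonneg (ha e) (sq_nonneg (edgeLoad path g e - edgeLoad path f e / 2))]
  have hsum := Finset.sum_le_sum fun e (_ : e ∈ Finset.univ) => hedge e
  rw [Finset.sum_add_distrib, Finset.sum_sub_distrib, ← Finset.sum_div,
    sum_edgeLoad_mul_eq_sum_mul_pathCost, sum_edgeLoad_mul_eq_sum_mul_pathCost,
    hf.sum_mul_pathCost] at hsum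
  simp only [socialCost, edgeLoad_div]
  linarith [hf.mul_le_sum_mul_pathCost hg]
end
end
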